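/- Let n ≥ 1 and let Γ be a finite subgroup of the orthogonal group O(n) that is generated by reflections. Then there exists a closed convex cone C ⊆ ℝⁿ such that the map C → ℝⁿ/Γ sending x to its orbit Γx is a surjective isometry onto the quotient metric space ℝⁿ/Γ; in particular, ℝⁿ/Γ is isometric to a closed convex subset of ℝⁿ and hence is a CAT(0) space. -/

import Mathlib

open scoped RealInnerProductSpace

noncomputable section

/-- Euclidean space `ℝⁿ`. -/
abbrev E (n : ℕ) : Type := EuclideanSpace ℝ (Fin n)

/-- The orthogonal group `O(n)`, realized as the group of linear isometric
self-equivalences of `ℝⁿ`. -/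
abbrev On (n : ℕ) : Type := E n ≃ₗᵢ[ℝ] E n

/-- The fixed-point subspace of a linear isometry. -/
def fixedSubmodule {K : Type} [NormedAddCommGroup K] [NormedSpace ℝ K]
    (g : K ≃ₗᵢ[ℝ] K) : Submodule ℝ K :=
  LinearMap.eqLocus (g.toLinearEquiv : K →ₗ[ℝ] K) LinearMap.id

/-- A reflection is an orthogonal transformation whose fixed-point subspace is a
hyperplane (has codimension one). -/
def IsReflection {K : Type} [NormedAddCommGroup K] [NormedSpace ℝ K]
    (g : K ≃ₗᵢ[ℝ] K) : Prop :=
  Module.finrank ℝ (fixedSubmodule g) = Module.finrank ℝ K - 1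

/-- A subgroup of `O(n)` is generated by reflections if it is the subgroup generated by
the reflections it contains. -/
def GeneratedByReflections {n : ℕ} (Γ : Subgroup (On n)) : Prop :=
  Subgroup.closure {g : On n | g ∈ Γ ∧ IsReflection g} = Γ

/-- The orbit equivalence relation of `Γ ≤ O(n)` on `ℝⁿ`. -/
def orbitSetoid {n : ℕ} (Γ : Subgroup (On n)) : Setoid (E n) where
  r x y := ∃ g ∈ Γ, g y = x
  iseqv := by
    constructor
    · exact fun x => ⟨1, Γ.one_mem, rfl⟩
    · rintro x y ⟨g, hg, rfl⟩
      exact ⟨g⁻¹, Γ.inv_mem hg, g.symm_apply_apply y⟩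
    · rintro x y z ⟨g, hg, rfl⟩ ⟨h, hh, rfl⟩
      exact ⟨g * h, Γ.mul_mem hg hh, rfl⟩

/-- The quotient metric on the orbit space `ℝⁿ/Γ`:
`d(Γx, Γy) = min_{g ∈ Γ} ‖x - g y‖`. -/
def quotDist {n : ℕ} (Γ : Subgroup (On n)) (X Y : Quotient (orbitSetoid Γ)) : ℝ :=
  ⨅ g : Γ, dist X.out ((g : On n) Y.out)

/-- `γ` is a (unit-speed) geodesic from `p` to `q` with respect to the distance
function `d`. -/
def IsGeodesicFn {X : Type*} (d : X → X → ℝ) (p q : X) (γ : ℝ → X) : Prop :=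
  γ 0 = p ∧ γ (d p q) = q ∧
    ∀ s ∈ Set.Icc (0 : ℝ) (d p q), ∀ t ∈ Set.Icc (0 : ℝ) (d p q), d (γ s) (γ t) = |s - t|

/-- `d` is a metric: symmetric, separating and satisfying the triangle inequality. -/
def IsMetricFn {X : Type*} (d : X → X → ℝ) : Prop :=
  (∀ x y, d x y = 0 ↔ x = y) ∧ (∀ x y, d x y = d y x) ∧
    ∀ x y z, d x z ≤ d x y + d y z

/-- A distance function `d` on `X` makes `X` a CAT(0) space if it is a geodesic metric
space in which every geodesic triangle satisfies the CAT(0) comparison inequality with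
respect to a Euclidean comparison triangle: for a triangle with vertices `p, q, r`,
sides issuing from `p` given by geodesics `γpq`, `γpr`, and a comparison triangle
`p', q', r'` in the Euclidean plane with the same side lengths, the distance between
points on the two sides is bounded by the Euclidean distance between the comparison
points on the corresponding sides of the comparison triangle. -/
def IsCAT0 {X : Type*} (d : X → X → ℝ) : Prop :=
  IsMetricFn d ∧ (∀ p q : X, ∃ γ : ℝ → X, IsGeodesicFn d p q γ) ∧
    ∀ p q r : X, ∀ γpq γpr : ℝ → X, IsGeodesicFn d p q γpq → IsGeodesicFn d p r γpr →
      ∀ p' q' r' : EuclideanSpace ℝ (Fin 2),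
        dist p' q' = d p q → dist p' r' = d p r → dist q' r' = d q r →
        ∀ s ∈ Set.Icc (0 : ℝ) (d p q), ∀ t ∈ Set.Icc (0 : ℝ) (d p r),
          d (γpq s) (γpr t) ≤
            dist (AffineMap.lineMap p' q' (s / d p q)) (AffineMap.lineMap p' r' (t / d p r))

/-- The unit sphere `Sⁿ⁻¹ ⊆ ℝⁿ`. -/
abbrev Sph (n : ℕ) : Type := {v : E n // ‖v‖ = 1}

/-- The orbit equivalence relation of `Γ ≤ O(n)` on the unit sphere. -/
def sphSetoid {n : ℕ} (Γ : Subgroup (On n)) : Setoid (Sph n) where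
  r x y := ∃ g ∈ Γ, g (y : E n) = (x : E n)
  iseqv := by
    constructor
    · exact fun x => ⟨1, Γ.one_mem, rfl⟩
    · rintro ⟨x, hx⟩ ⟨y, hy⟩ ⟨g, hg, h⟩
      refine ⟨g⁻¹, Γ.inv_mem hg, ?_⟩
      simp only [Subtype.coe_mk] at h ⊢
      rw [← h]
      exact g.symm_apply_apply y
    · rintro x y z ⟨g, hg, h⟩ ⟨k, hk, h'⟩
      refine ⟨g * k, Γ.mul_mem hg hk, ?_⟩
      rw [← h, ← h']
      rfl

/-- The quotient metric on the orbit space `Sⁿ⁻¹/Γ`: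
`d(Γu, Γv) = min_{g ∈ Γ} ∠(u, g v) = min_{g ∈ Γ} arccos ⟪u, g v⟫`. -/
def sphDist {n : ℕ} (Γ : Subgroup (On n)) (X Y : Quotient (sphSetoid Γ)) : ℝ :=
  ⨅ g : Γ, Real.arccos ⟪(X.out : E n), (g : On n) (Y.out : E n)⟫

section Reflections

variable {V : Type*} [NormedAddCommGroup V] [InnerProductSpace ℝ V]

/-- The orthogonal reflection in the hyperplane with normal vector `a`. -/
def hypRefl (a : V) : V ≃ₗᵢ[ℝ] V := (ℝ ∙ a)ᗮ.reflection

lemma hypRefl_apply {a : V} (ha : ‖a‖ = 1) (x : V) :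
    hypRefl a x = x - (2 * ⟪a, x⟫) • a := by
  rw [hypRefl, Submodule.reflection_orthogonal_apply, Submodule.reflection_singleton_apply]
  simp only [ha, RCLike.ofReal_real_eq_id, id, one_pow, div_one]
  module

lemma hypRefl_hypRefl (a x : V) : hypRefl a (hypRefl a x) = x :=
  Submodule.reflection_reflection _ x

lemma hypRefl_mul_self (a : V) : hypRefl a * hypRefl a = 1 :=
  Submodule.reflection_mul_reflection _

lemma hypRefl_self (a : V) : hypRefl a a = -a :=
  Submodule.reflection_orthogonalComplement_singleton_eq_neg a

lemma hypRefl_neg (a : V) : hypRefl (-a) = hypRefl a := by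
  have h : (ℝ ∙ -a) = ℝ ∙ a := by
    rw [← Set.neg_singleton, Submodule.span_neg]
  simp only [hypRefl, h]

lemma inner_hypRefl_left (a x y : V) : ⟪hypRefl a x, y⟫ = ⟪x, hypRefl a y⟫ := by
  rw [← (hypRefl a).inner_map_map x, hypRefl_hypRefl]

lemma hypRefl_map {a : V} (ha : ‖a‖ = 1) (g : V ≃ₗᵢ[ℝ] V) :
    hypRefl (g a) = g * hypRefl a * g⁻¹ := by
  ext x
  have hga : ‖g a‖ = 1 := by rw [g.norm_map, ha]
  obtain ⟨y, rfl⟩ := g.surjective x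
  have h : g⁻¹ (g y) = y := g.symm_apply_apply y
  change _ = g (hypRefl a (g⁻¹ (g y)))
  rw [h, hypRefl_apply hga, hypRefl_apply ha, g.inner_map_map, map_sub, map_smul]

lemma eq_or_eq_neg_of_hypRefl_eq {a b : V} (ha : ‖a‖ = 1) (hb : ‖b‖ = 1)
    (h : hypRefl a = hypRefl b) : b = a ∨ b = -a := by
  have h1 : hypRefl a b = -b := by rw [h, hypRefl_self]
  rw [hypRefl_apply ha] at h1
  have h2 : b = ⟪a, b⟫ • a := by
    have : (2 : ℝ) • b = (2 : ℝ) • (⟪a, b⟫ • a) := by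
      rw [smul_smul, two_smul, ← sub_eq_zero]
      rw [← sub_eq_zero] at h1
      rw [← h1]; abel
    exact smul_right_injective V two_ne_zero this
  have h3 : |⟪a, b⟫| = 1 := by
    have := congrArg norm h2
    rwa [norm_smul, ha, hb, mul_one, Real.norm_eq_abs, eq_comm] at this
  rcases (abs_eq zero_le_one).1 h3 with h4 | h4 <;> rw [h4] at h2
  · left; simpa using h2
  · right; simpa using h2

/-- The unit normal vectors of the reflecting hyperplanes of `Γ`. -/
def rootSet (Γ : Subgroup (V ≃ₗᵢ[ℝ] V)) : Set V := {a | ‖a‖ = 1 ∧ hypRefl a ∈ Γ}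

variable {Γ : Subgroup (V ≃ₗᵢ[ℝ] V)} {p : V}

lemma map_mem_rootSet {a : V} (ha : a ∈ rootSet Γ) {g : V ≃ₗᵢ[ℝ] V} (hg : g ∈ Γ) :
    g a ∈ rootSet Γ :=
  ⟨by rw [g.norm_map, ha.1],
    by rw [hypRefl_map ha.1]; exact Γ.mul_mem (Γ.mul_mem hg ha.2) (Γ.inv_mem hg)⟩

lemma neg_mem_rootSet {a : V} (ha : a ∈ rootSet Γ) : -a ∈ rootSet Γ :=
  ⟨by rw [norm_neg, ha.1], by rw [hypRefl_neg]; exact ha.2⟩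

lemma finite_rootSet [Finite Γ] : (rootSet Γ).Finite := by
  refine Set.Finite.of_finite_fibers hypRefl ?_ ?_
  · refine (Set.toFinite (Γ : Set (V ≃ₗᵢ[ℝ] V))).subset ?_
    rintro _ ⟨a, ha, rfl⟩
    exact ha.2
  · rintro _ ⟨a, ha, rfl⟩
    refine (Set.toFinite {a, -a}).subset ?_
    rintro b ⟨hb, hab⟩
    exact eq_or_eq_neg_of_hypRefl_eq ha.1 hb.1 (Eq.symm hab)

lemma exists_inner_rootSet_ne_zero [Finite Γ] : ∃ p : V, ∀ a ∈ rootSet Γ, ⟪p, a⟫ ≠ 0 := by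
  have := (finite_rootSet (Γ := Γ)).to_subtype
  obtain ⟨p, hp⟩ := Module.Dual.exists_forall_ne_zero_of_forall_exists
    (fun a : rootSet Γ ↦ (innerₗ V (a : V) : Module.Dual ℝ V))
    (fun a ↦ ⟨a, by simp [a.2.1]⟩)
  refine ⟨p, fun a ha ↦ ?_⟩
  rw [real_inner_comm]
  exact hp ⟨a, ha⟩

/-- The roots of `Γ` which are positive with respect to the linear order defined by `p`. -/
def posRoots (Γ : Subgroup (V ≃ₗᵢ[ℝ] V)) (p : V) : Set V := {a ∈ rootSet Γ | 0 < ⟪p, a⟫}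

/-- The positive roots whose reflection permutes the remaining positive roots. -/
def simpleRoots (Γ : Subgroup (V ≃ₗᵢ[ℝ] V)) (p : V) : Set V :=
  {a ∈ posRoots Γ p | ∀ b ∈ posRoots Γ p, b ≠ a → hypRefl a b ∈ posRoots Γ p}

/-- The closed chamber cut out by the positive roots. -/
def chamber (Γ : Subgroup (V ≃ₗᵢ[ℝ] V)) (p : V) : Set V :=
  {x | ∀ a ∈ posRoots Γ p, 0 ≤ ⟪x, a⟫}

lemma mem_posRoots_or_neg_mem (hp : ∀ a ∈ rootSet Γ, ⟪p, a⟫ ≠ 0) {a : V} (ha : a ∈ rootSet Γ) :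
    a ∈ posRoots Γ p ∨ -a ∈ posRoots Γ p := by
  rcases lt_or_gt_of_ne (hp a ha) with h | h
  · exact .inr ⟨neg_mem_rootSet ha, by rw [inner_neg_right]; linarith⟩
  · exact .inl ⟨ha, h⟩

/-- If `b` is not simple, then `hypRefl b` is a product of reflections in lower positive roots. -/
lemma exists_lower_conj (hp : ∀ a ∈ rootSet Γ, ⟪p, a⟫ ≠ 0) {b : V} (hb : b ∈ posRoots Γ p)
    (hbs : b ∉ simpleRoots Γ p) :
    ∃ c ∈ posRoots Γ p, ∃ d ∈ posRoots Γ p, ⟪p, c⟫ < ⟪p, b⟫ ∧ ⟪p, d⟫ < ⟪p, b⟫ ∧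
      hypRefl b = hypRefl c * hypRefl d * hypRefl c := by
  suffices H : ∃ c ∈ posRoots Γ p, 0 < ⟪b, c⟫ ∧ ⟪b, c⟫ < 1 ∧ ⟪p, c⟫ < ⟪p, b⟫ by
    obtain ⟨c, hc, h0, h1, hcb⟩ := H
    have hconj : hypRefl (hypRefl c b) = hypRefl c * hypRefl b * hypRefl c := by
      rw [hypRefl_map hb.1.1, inv_eq_of_mul_eq_one_left (hypRefl_mul_self c)]
    have hconj' : hypRefl b = hypRefl c * hypRefl (hypRefl c b) * hypRefl c := by
      rw [hconj]
      simp only [mul_assoc, hypRefl_mul_self, mul_one]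
      rw [← mul_assoc, hypRefl_mul_self, one_mul]
    have hval : ⟪p, hypRefl c b⟫ = ⟪p, b⟫ - 2 * ⟪b, c⟫ * ⟪p, c⟫ := by
      rw [hypRefl_apply hc.1.1, inner_sub_right, inner_smul_right, real_inner_comm b c]
    have hpc := hc.2
    rcases mem_posRoots_or_neg_mem hp (map_mem_rootSet hb.1 hc.1.2) with h | h
    · refine ⟨c, hc, _, h, hcb, ?_, hconj'⟩
      rw [hval]
      have := mul_pos h0 hpc
      linarith
    · refine ⟨c, hc, _, h, hcb, ?_, by rw [hypRefl_neg]; exact hconj'⟩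
      rw [inner_neg_right, hval]
      nlinarith
  obtain ⟨c, hc, hcb, hbc⟩ : ∃ c ∈ posRoots Γ p, c ≠ b ∧ hypRefl b c ∉ posRoots Γ p := by
    by_contra! h
    exact hbs ⟨hb, h⟩
  have hd := (mem_posRoots_or_neg_mem hp (map_mem_rootSet hc.1 hb.1.2)).resolve_left hbc
  set d := -hypRefl b c with hd_def
  have hsum : ⟪p, d⟫ = 2 * ⟪b, c⟫ * ⟪p, b⟫ - ⟪p, c⟫ := by
    rw [hd_def, hypRefl_apply hb.1.1, inner_neg_right, inner_sub_right, inner_smul_right]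
    ring
  have hbd : ⟪b, d⟫ = ⟪b, c⟫ := by
    rw [hd_def, inner_neg_right, ← inner_hypRefl_left, hypRefl_self, inner_neg_left, neg_neg]
  have hlt : ⟪b, c⟫ < 1 := (inner_lt_one_iff_real_of_norm_eq_one hb.1.1 hc.1.1).2 hcb.symm
  have hpb := hb.2
  have hpc := hc.2
  have hpd := hd.2
  have hpos : 0 < ⟪b, c⟫ := by
    by_contra! h
    nlinarith
  by_cases h : ⟪p, c⟫ < ⟪p, b⟫
  · exact ⟨c, hc, hpos, hlt, h⟩
  · exact ⟨d, hd, by rwa [hbd], by rwa [hbd], by nlinarith⟩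

lemma hypRefl_mem_closure_simpleRoots [Finite Γ] (hp : ∀ a ∈ rootSet Γ, ⟪p, a⟫ ≠ 0) {b : V}
    (hb : b ∈ posRoots Γ p) :
    hypRefl b ∈ Subgroup.closure (hypRefl '' simpleRoots Γ p) := by
  by_contra hbad
  have hfin : {b ∈ posRoots Γ p |
      hypRefl b ∉ Subgroup.closure (hypRefl '' simpleRoots Γ p)}.Finite :=
    (finite_rootSet (Γ := Γ)).subset fun _ h ↦ h.1.1
  obtain ⟨m, ⟨hm, hmbad⟩, hmin⟩ :=
    Set.exists_min_image _ (fun a ↦ ⟪p, a⟫) hfin ⟨b, hb, hbad⟩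
  by_cases hs : m ∈ simpleRoots Γ p
  · exact hmbad (Subgroup.subset_closure ⟨m, hs, rfl⟩)
  obtain ⟨c, hc, d, hd, hcm, hdm, heq⟩ := exists_lower_conj hp hm hs
  have key {a : V} (ha : a ∈ posRoots Γ p) (ham : ⟪p, a⟫ < ⟪p, m⟫) :
      hypRefl a ∈ Subgroup.closure (hypRefl '' simpleRoots Γ p) := by
    by_contra h
    exact (hmin a ⟨ha, h⟩).not_gt ham
  refine hmbad ?_
  rw [heq]
  exact mul_mem (mul_mem (key hc hcm) (key hd hdm)) (key hc hcm)

/-- The product of the reflections in the vectors of a list. -/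
def reflProd (l : List V) : V ≃ₗᵢ[ℝ] V := (l.map hypRefl).prod

lemma reflProd_cons (a : V) (l : List V) : reflProd (a :: l) = hypRefl a * reflProd l := by
  simp only [reflProd, List.map_cons, List.prod_cons]

lemma exists_reflProd_eq [Finite Γ] (hp : ∀ a ∈ rootSet Γ, ⟪p, a⟫ ≠ 0)
    (hΓ : Γ ≤ Subgroup.closure (hypRefl '' rootSet Γ)) {g : V ≃ₗᵢ[ℝ] V} (hg : g ∈ Γ) :
    ∃ l : List V, (∀ a ∈ l, a ∈ simpleRoots Γ p) ∧ reflProd l = g := by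
  have hle : Subgroup.closure (hypRefl '' rootSet Γ) ≤
      Subgroup.closure (hypRefl '' simpleRoots Γ p) := by
    rw [Subgroup.closure_le]
    rintro _ ⟨a, ha, rfl⟩
    rcases mem_posRoots_or_neg_mem hp ha with h | h
    · exact hypRefl_mem_closure_simpleRoots hp h
    · rw [← hypRefl_neg]
      exact hypRefl_mem_closure_simpleRoots hp h
  have hmem := hle (hΓ hg)
  clear hg
  induction hmem using Subgroup.closure_induction_left with
  | one => exact ⟨[], by simp, rfl⟩
  | mul_left x hx y _ ih =>
    obtain ⟨a, ha, rfl⟩ := hx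
    obtain ⟨l, hl, rfl⟩ := ih
    exact ⟨a :: l, by simpa using ⟨ha, hl⟩, reflProd_cons a l⟩
  | inv_mul_cancel x hx y _ ih =>
    obtain ⟨a, ha, rfl⟩ := hx
    obtain ⟨l, hl, rfl⟩ := ih
    refine ⟨a :: l, by simpa using ⟨ha, hl⟩, ?_⟩
    rw [inv_eq_of_mul_eq_one_left (hypRefl_mul_self a), reflProd_cons]

lemma reflProd_mem {l : List V} (hl : ∀ a ∈ l, a ∈ simpleRoots Γ p) : reflProd l ∈ Γ := by
  refine Γ.list_prod_mem fun g hg ↦ ?_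
  obtain ⟨a, ha, rfl⟩ := List.mem_map.1 hg
  exact (hl a ha).1.1.2

/-- The exchange property of words in simple reflections. -/
lemma exists_shorter_word {l : List V} (hl : ∀ a ∈ l, a ∈ simpleRoots Γ p) {a : V}
    (ha : a ∈ posRoots Γ p) (hneg : ⟪reflProd l p, a⟫ < 0) :
    ∃ l' : List V, (∀ a ∈ l', a ∈ simpleRoots Γ p) ∧ l'.length < l.length ∧
      reflProd l' = hypRefl a * reflProd l := by
  induction l generalizing a with
  | nil => exact absurd ha.2 (not_lt.2 (le_of_lt hneg))
  | cons c l ih =>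
    simp only [List.mem_cons, forall_eq_or_imp] at hl
    by_cases hac : a = c
    · subst hac
      refine ⟨l, hl.2, by simp, ?_⟩
      rw [reflProd_cons, ← mul_assoc, hypRefl_mul_self, one_mul]
    · have hneg' : ⟪reflProd l p, hypRefl c a⟫ < 0 := by
        rw [← inner_hypRefl_left]
        rwa [reflProd_cons] at hneg
      obtain ⟨l', hl', hlen, hprod⟩ := ih hl.2 (hl.1.2 a ha hac) hneg'
      refine ⟨c :: l', by simpa using ⟨hl.1, hl'⟩, by simpa using hlen, ?_⟩
      rw [reflProd_cons, reflProd_cons, hprod, hypRefl_map ha.1.1,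
        inv_eq_of_mul_eq_one_left (hypRefl_mul_self c)]
      simp only [← mul_assoc, hypRefl_mul_self, one_mul]

lemma inner_reflProd_le (hp : ∀ a ∈ rootSet Γ, ⟪p, a⟫ ≠ 0) {x y : V} (hx : x ∈ chamber Γ p)
    (hy : y ∈ chamber Γ p) (l : List V) (hl : ∀ a ∈ l, a ∈ simpleRoots Γ p) :
    ⟪x, reflProd l y⟫ ≤ ⟪x, y⟫ := by
  induction hn : l.length using Nat.strong_induction_on generalizing l with
  | h n ih =>
    subst hn
    cases l with
    | nil => exact le_rfl
    | cons a l =>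
      simp only [List.mem_cons, forall_eq_or_imp] at hl
      have ha := hl.1.1
      rcases lt_or_ge ⟪reflProd l p, a⟫ 0 with hneg | hnonneg
      · obtain ⟨l', hl', hlen, hprod⟩ := exists_shorter_word hl.2 ha hneg
        rw [reflProd_cons, ← hprod]
        exact ih _ (by simp only [List.length_cons]; lia) l' hl' rfl
      · have hinv : ∀ z, ⟪reflProd l z, a⟫ = ⟪z, (reflProd l)⁻¹ a⟫ := fun z ↦ by
          rw [← (reflProd l).inner_map_map z]
          congr 1
          exact ((reflProd l).apply_symm_apply a).symm
        have hroot := map_mem_rootSet ha.1 (Γ.inv_mem (reflProd_mem hl.2))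
        have hpos : 0 ≤ ⟪reflProd l y, a⟫ := by
          rw [hinv] at hnonneg ⊢
          exact hy _ ⟨hroot, lt_of_le_of_ne hnonneg (hp _ hroot).symm⟩
        have hxa := hx a ha
        calc ⟪x, reflProd (a :: l) y⟫ = ⟪x, hypRefl a (reflProd l y)⟫ := by
              rw [reflProd_cons]; rfl
          _ = ⟪x, reflProd l y⟫ - 2 * ⟪reflProd l y, a⟫ * ⟪x, a⟫ := by
              rw [hypRefl_apply ha.1.1, inner_sub_right, inner_smul_right,
                real_inner_comm (reflProd l y) a]
          _ ≤ ⟪x, reflProd l y⟫ := by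
              have := mul_nonneg hpos hxa
              linarith
          _ ≤ ⟪x, y⟫ := ih _ (by simp) l hl.2 rfl

lemma dist_le_dist_of_mem_chamber [Finite Γ] (hp : ∀ a ∈ rootSet Γ, ⟪p, a⟫ ≠ 0)
    (hΓ : Γ ≤ Subgroup.closure (hypRefl '' rootSet Γ)) {x y : V} (hx : x ∈ chamber Γ p)
    (hy : y ∈ chamber Γ p) {g : V ≃ₗᵢ[ℝ] V} (hg : g ∈ Γ) : dist x y ≤ dist x (g y) := by
  obtain ⟨l, hl, rfl⟩ := exists_reflProd_eq hp hΓ hg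
  have h := inner_reflProd_le hp hx hy l hl
  rw [dist_eq_norm, dist_eq_norm]
  refine le_of_sq_le_sq ?_ (norm_nonneg _)
  rw [norm_sub_sq_real, norm_sub_sq_real, LinearIsometryEquiv.norm_map]
  linarith

lemma exists_map_mem_chamber [Finite Γ] (x : V) : ∃ g ∈ Γ, g x ∈ chamber Γ p := by
  obtain ⟨g, hg⟩ := Finite.exists_max fun g : Γ ↦ ⟪p, (g : V ≃ₗᵢ[ℝ] V) x⟫
  refine ⟨g, g.2, fun a ha ↦ ?_⟩
  have h := hg ⟨hypRefl a * g, Γ.mul_mem ha.1.2 g.2⟩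
  change ⟪p, hypRefl a ((g : V ≃ₗᵢ[ℝ] V) x)⟫ ≤ _ at h
  rw [hypRefl_apply ha.1.1, inner_sub_right, inner_smul_right, real_inner_comm _ a] at h
  have hpa := ha.2
  by_contra! hneg
  have := mul_pos_of_neg_of_neg hneg (neg_neg_of_pos hpa)
  linarith

lemma isClosed_chamber : IsClosed (chamber Γ p) := by
  have : chamber Γ p = ⋂ a ∈ posRoots Γ p, {x | 0 ≤ ⟪x, a⟫} := by
    ext x; simp [chamber]
  rw [this]
  exact isClosed_biInter fun a _ ↦ isClosed_le continuous_const (by fun_prop)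

lemma convex_chamber : Convex ℝ (chamber Γ p) := by
  intro x hx y hy s t hs ht _ a ha
  rw [inner_add_left, real_inner_smul_left, real_inner_smul_left]
  exact add_nonneg (mul_nonneg hs (hx a ha)) (mul_nonneg ht (hy a ha))

lemma smul_mem_chamber {x : V} (hx : x ∈ chamber Γ p) {r : ℝ} (hr : 0 ≤ r) :
    r • x ∈ chamber Γ p := by
  intro a ha
  rw [real_inner_smul_left]
  exact mul_nonneg hr (hx a ha)

end Reflections

/-- A linear isometry fixing exactly a hyperplane is the reflection in a unit normal of it. -/
lemma IsReflection.exists_eq_hypRefl {K : Type} [NormedAddCommGroup K] [InnerProductSpace ℝ K]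
    [FiniteDimensional ℝ K] (hK : 1 ≤ Module.finrank ℝ K) {g : K ≃ₗᵢ[ℝ] K}
    (hg : IsReflection g) : ∃ a : K, ‖a‖ = 1 ∧ g = hypRefl a := by
  have hfix : ∀ x, x ∈ fixedSubmodule g ↔ g x = x := fun x ↦ Iff.rfl
  have hrank : Module.finrank ℝ (fixedSubmodule g)ᗮ = 1 := by
    have h1 := (fixedSubmodule g).finrank_add_finrank_orthogonal
    unfold IsReflection at hg
    lia
  obtain ⟨a, haF, ha⟩ : ∃ a ∈ (fixedSubmodule g)ᗮ, ‖a‖ = 1 := by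
    obtain ⟨v, hv, hv0⟩ := Submodule.exists_mem_ne_zero_of_ne_bot
      (Submodule.one_le_finrank_iff.1 hrank.ge)
    exact ⟨‖v‖⁻¹ • v, Submodule.smul_mem _ _ hv, norm_smul_inv_norm (𝕜 := ℝ) hv0⟩
  have hspan : ∀ z ∈ (fixedSubmodule g)ᗮ, ∃ t : ℝ, t • a = z := fun z hz ↦ by
    have ha0 : (⟨a, haF⟩ : (fixedSubmodule g)ᗮ) ≠ 0 := by
      rintro h
      rw [Submodule.mk_eq_zero] at h
      simp [h] at ha
    obtain ⟨t, ht⟩ := (finrank_eq_one_iff_of_nonzero' _ ha0).1 hrank ⟨z, hz⟩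
    exact ⟨t, congrArg Subtype.val ht⟩
  have hga : g a = -a := by
    have hmem : g a ∈ (fixedSubmodule g)ᗮ := by
      rw [Submodule.mem_orthogonal] at haF ⊢
      intro y hy
      rw [← (hfix y).1 hy, g.inner_map_map]
      exact haF y hy
    obtain ⟨t, ht⟩ := hspan _ hmem
    have habs : |t| = 1 := by
      have := congrArg norm ht
      rwa [norm_smul, g.norm_map, ha, mul_one, Real.norm_eq_abs] at this
    rcases (abs_eq zero_le_one).1 habs with h | h
    · rw [h, one_smul] at ht
      have := Submodule.inner_right_of_mem_orthogonal ((hfix a).2 ht.symm) haF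
      rw [real_inner_self_eq_norm_sq, ha] at this
      norm_num at this
    · rw [← ht, h, neg_one_smul]
  refine ⟨a, ha, ?_⟩
  ext x
  have hx : g (x - ⟪a, x⟫ • a) = x - ⟪a, x⟫ • a := by
    rw [← hfix, ← (fixedSubmodule g).orthogonal_orthogonal, Submodule.mem_orthogonal]
    intro z hz
    obtain ⟨t, rfl⟩ := hspan z hz
    rw [real_inner_smul_left, inner_sub_right, inner_smul_right, real_inner_self_eq_norm_sq, ha]
    ring
  rw [map_sub, map_smul, hga, sub_eq_iff_eq_add] at hx
  rw [hx, hypRefl_apply ha]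
  module

section CAT0

lemma dist_sq_lineMap_lineMap {H : Type*} [NormedAddCommGroup H] [InnerProductSpace ℝ H]
    (p q r : H) (u v : ℝ) :
    dist (AffineMap.lineMap p q u) (AffineMap.lineMap p r v) ^ 2 =
      u ^ 2 * dist p q ^ 2 + v ^ 2 * dist p r ^ 2 -
        u * v * (dist p q ^ 2 + dist p r ^ 2 - dist q r ^ 2) := by
  have h1 : (AffineMap.lineMap p q u : H) - AffineMap.lineMap p r v =
      u • (q - p) - v • (r - p) := by
    simp [AffineMap.lineMap_apply]
  have h2 : q - r = (q - p) - (r - p) := by abel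
  rw [dist_comm p q, dist_comm p r, dist_eq_norm, dist_eq_norm, dist_eq_norm, dist_eq_norm, h1, h2,
    norm_sub_sq_real (q - p), norm_sub_sq_real (u • _), norm_smul, norm_smul, mul_pow, mul_pow,
    Real.norm_eq_abs, Real.norm_eq_abs, sq_abs, sq_abs, real_inner_smul_left,
    real_inner_smul_right]
  ring

variable {X : Type*} {d : X → X → ℝ} {H : Type*} [NormedAddCommGroup H] [InnerProductSpace ℝ H]
  {σ : X → H}

lemma IsGeodesicFn.map_eq_lineMap (hd : ∀ x y, d x y = dist (σ x) (σ y)) {p q : X} {γ : ℝ → X}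
    (hγ : IsGeodesicFn d p q γ) {s : ℝ} (hs : s ∈ Set.Icc 0 (d p q)) :
    σ (γ s) = AffineMap.lineMap (σ p) (σ q) (s / d p q) := by
  obtain ⟨h0, h1, h⟩ := hγ
  have hD : 0 ≤ d p q := hs.1.trans hs.2
  have hmul : s / d p q * d p q = s := by
    rcases hD.eq_or_lt with hz | hpos
    · have : s = 0 := le_antisymm (hs.2.trans hz.ge) hs.1
      simp [this]
    · exact div_mul_cancel₀ _ hpos.ne'
  apply eq_lineMap_of_dist_eq_mul_of_dist_eq_mul
  · rw [← hd, ← hd, hmul]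
    have := h 0 ⟨le_rfl, hD⟩ s hs
    rwa [h0, zero_sub, abs_neg, abs_of_nonneg hs.1] at this
  · rw [← hd, ← hd, sub_mul, one_mul, hmul]
    have := h s hs (d p q) ⟨hD, le_rfl⟩
    rwa [h1, abs_sub_comm, abs_of_nonneg (sub_nonneg.2 hs.2)] at this

/-- A space isometric to a convex subset of an inner product space is CAT(0). -/
lemma IsCAT0.of_convex_range (hd : ∀ x y, d x y = dist (σ x) (σ y))
    (hσ : Function.Injective σ) (hconv : Convex ℝ (Set.range σ)) : IsCAT0 d := by
  refine ⟨⟨fun x y ↦ ?_, fun x y ↦ ?_, fun x y z ↦ ?_⟩, fun p q ↦ ?_, ?_⟩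
  · rw [hd, dist_eq_zero, hσ.eq_iff]
  · rw [hd, hd, dist_comm]
  · simp only [hd]
    exact dist_triangle _ _ _
  · have : Nonempty X := ⟨p⟩
    have hD : 0 ≤ d p q := by rw [hd]; exact dist_nonneg
    let γ : ℝ → X := fun t ↦ Function.invFun σ (AffineMap.lineMap (σ p) (σ q) (t / d p q))
    have hγ : ∀ t ∈ Set.Icc 0 (d p q),
        σ (γ t) = AffineMap.lineMap (σ p) (σ q) (t / d p q) := fun t ht ↦
      Function.invFun_eq (hconv.lineMap_mem ⟨p, rfl⟩ ⟨q, rfl⟩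
        ⟨div_nonneg ht.1 hD, div_le_one_of_le₀ ht.2 hD⟩)
    refine ⟨γ, hσ ?_, hσ ?_, fun s hs t ht ↦ ?_⟩
    · rw [hγ 0 ⟨le_rfl, hD⟩]
      simp
    · rw [hγ _ ⟨hD, le_rfl⟩]
      rcases hD.eq_or_lt with hz | hpos
      · rw [← hz, div_zero, AffineMap.lineMap_apply_zero, ← dist_eq_zero, ← hd, hz]
      · rw [div_self hpos.ne', AffineMap.lineMap_apply_one]
    · rw [hd, hγ s hs, hγ t ht, dist_lineMap_lineMap, ← hd, Real.dist_eq, ← sub_div, abs_div,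
        abs_of_nonneg hD]
      rcases hD.eq_or_lt with hz | hpos
      · rw [← hz, Set.Icc_self, Set.mem_singleton_iff] at hs ht
        simp [hs, ht]
      · exact div_mul_cancel₀ _ hpos.ne'
  · intro p q r γpq γpr hpq hpr p' q' r' h1 h2 h3 s hs t ht
    rw [hd (γpq s), hpq.map_eq_lineMap hd hs, hpr.map_eq_lineMap hd ht]
    refine le_of_eq ((sq_eq_sq₀ dist_nonneg dist_nonneg).1 ?_)
    rw [dist_sq_lineMap_lineMap, dist_sq_lineMap_lineMap, h1, h2, h3, hd p q, hd p r, hd q r]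

end CAT0

lemma quotDist_mk {n : ℕ} (Γ : Subgroup (On n)) (x y : E n) :
    quotDist Γ (Quotient.mk (orbitSetoid Γ) x) (Quotient.mk (orbitSetoid Γ) y) =
      ⨅ g : Γ, dist x ((g : On n) y) := by
  obtain ⟨a, ha, hax⟩ := Quotient.mk_out (s := orbitSetoid Γ) x
  obtain ⟨b, hb, hby⟩ := Quotient.mk_out (s := orbitSetoid Γ) y
  let e : Γ ≃ Γ := (Equiv.mulLeft ⟨a, ha⟩⁻¹).trans (Equiv.mulRight ⟨b, hb⟩)
  refine Equiv.iInf_congr e fun g ↦ ?_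
  rw [← hax, ← hby, ← a.dist_map]
  congr 1
  exact a.apply_symm_apply _

/-- If `Γ` is a finite subgroup of `O(n)` (`n ≥ 1`) generated by
reflections, then there is a closed convex cone `C ⊆ ℝⁿ` such that `x ↦ Γx` maps `C`
bijectively onto `ℝⁿ/Γ` preserving distances; in particular `ℝⁿ/Γ` is isometric to a
closed convex subset of `ℝⁿ` and hence is CAT(0). -/
theorem stmt1 (n : ℕ) (hn : 1 ≤ n) (Γ : Subgroup (On n)) (hfin : Finite Γ)
    (hrefl : GeneratedByReflections Γ) :
    ∃ C : Set (E n), IsClosed C ∧ Convex ℝ C ∧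
      (∀ x ∈ C, ∀ r : ℝ, 0 ≤ r → r • x ∈ C) ∧
      (∀ X : Quotient (orbitSetoid Γ), ∃ x ∈ C, Quotient.mk (orbitSetoid Γ) x = X) ∧
      (∀ x ∈ C, ∀ y ∈ C,
        quotDist Γ (Quotient.mk (orbitSetoid Γ) x) (Quotient.mk (orbitSetoid Γ) y)
          = dist x y) ∧
      IsCAT0 (quotDist Γ) := by
  have hΓ : Γ ≤ Subgroup.closure (hypRefl '' rootSet Γ) := by
    conv_lhs => rw [← hrefl]
    refine Subgroup.closure_mono ?_
    rintro g ⟨hg, hgr⟩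
    obtain ⟨a, ha, rfl⟩ := hgr.exists_eq_hypRefl (by simpa using hn)
    exact ⟨a, ⟨ha, hg⟩, rfl⟩
  obtain ⟨p, hp⟩ := exists_inner_rootSet_ne_zero (Γ := Γ)
  have hsurj : ∀ X : Quotient (orbitSetoid Γ),
      ∃ x ∈ chamber Γ p, Quotient.mk (orbitSetoid Γ) x = X := by
    rintro ⟨x⟩
    obtain ⟨g, hg, hgx⟩ := exists_map_mem_chamber (Γ := Γ) (p := p) x
    exact ⟨g x, hgx, Quotient.sound ⟨g, hg, rfl⟩⟩
  have hdist : ∀ x ∈ chamber Γ p, ∀ y ∈ chamber Γ p,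
      quotDist Γ (Quotient.mk (orbitSetoid Γ) x) (Quotient.mk (orbitSetoid Γ) y) = dist x y := by
    intro x hx y hy
    rw [quotDist_mk]
    refine le_antisymm (ciInf_le (Set.finite_range _).bddBelow (1 : Γ)) (le_ciInf fun g ↦ ?_)
    exact dist_le_dist_of_mem_chamber hp hΓ hx hy g.2
  refine ⟨chamber Γ p, isClosed_chamber, convex_chamber, fun x hx r hr ↦ smul_mem_chamber hx hr,
    hsurj, hdist, ?_⟩
  choose σ hσ hmk using hsurj
  refine IsCAT0.of_convex_range (σ := σ) (fun X Y ↦ ?_) (Function.LeftInverse.injective hmk) ?_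
  · rw [← hdist _ (hσ X) _ (hσ Y), hmk, hmk]
  · have hrange : Set.range σ = chamber Γ p := by
      refine Set.Subset.antisymm (Set.range_subset_iff.2 hσ) fun x hx ↦ ⟨Quotient.mk _ x, ?_⟩
      rw [← dist_eq_zero, ← hdist _ (hσ _) _ hx, hmk, hdist _ hx _ hx, dist_self]
    rw [hrange]
    exact convex_chamber

end
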